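/- Orientation rigidity of the Martinet plane (remark in the proof of Theorem 5): there is no real-analytic diffeomorphism germ Φ = (Φ₁, Φ₂) at 0 ∈ ℝ² with Φ(0) = 0 such that Φ₁(x,y)·det(DΦ)(x,y) = x near 0 (i.e. Φ preserves the Martinet 2-form x dx∧dy) and Φ₂(x,y) = −y near 0 (i.e. Φ sends the coordinate y to −y). -/

import Mathlib

open Filter Topology

/-- The partial derivative with respect to the first variable. -/
noncomputable def pdx (f : ℝ × ℝ → ℝ) (z : ℝ × ℝ) : ℝ := fderiv ℝ f z (1, 0)

/-- The partial derivative with respect to the second variable. -/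
noncomputable def pdy (f : ℝ × ℝ → ℝ) (z : ℝ × ℝ) : ℝ := fderiv ℝ f z (0, 1)

/-- The Jacobian determinant of a map `Φ : ℝ² → ℝ²`. -/
noncomputable def jacDet (Φ : ℝ × ℝ → ℝ × ℝ) (z : ℝ × ℝ) : ℝ :=
  pdx (fun w => (Φ w).1) z * pdy (fun w => (Φ w).2) z -
    pdy (fun w => (Φ w).1) z * pdx (fun w => (Φ w).2) z

/-- A germ of real-analytic diffeomorphism at `0 ∈ ℝ²` fixing `0`:
a real-analytic map with a real-analytic local inverse near `0`. -/
def IsAnalyticDiffeoGermAtZero (Φ : ℝ × ℝ → ℝ × ℝ) : Prop :=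
  AnalyticAt ℝ Φ 0 ∧ Φ 0 = 0 ∧
    ∃ Ψ : ℝ × ℝ → ℝ × ℝ, AnalyticAt ℝ Ψ 0 ∧ Ψ 0 = 0 ∧
      (∀ᶠ z in 𝓝 (0 : ℝ × ℝ), Ψ (Φ z) = z) ∧ (∀ᶠ z in 𝓝 (0 : ℝ × ℝ), Φ (Ψ z) = z)

/-- If `Φ₂ = -y` near `z`, the Jacobian determinant of `Φ` at `z` is `-∂ₓΦ₁`. -/
theorem jacDet_eq_neg_pdx {Φ : ℝ × ℝ → ℝ × ℝ} {z : ℝ × ℝ}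
    (h : ∀ᶠ w in 𝓝 z, (Φ w).2 = -w.2) :
    jacDet Φ z = -pdx (fun w => (Φ w).1) z := by
  have hf : fderiv ℝ (fun w => (Φ w).2) z = -ContinuousLinearMap.snd ℝ ℝ ℝ :=
    (EventuallyEq.fderiv_eq h).trans hasFDerivAt_snd.neg.fderiv
  simp [jacDet, pdx, pdy, hf]

/-- A function on a symmetric interval with `g 0 = 0` cannot satisfy `g g' = -t`. -/
theorem not_forall_hasDerivAt_mul_eq_neg {g g' : ℝ → ℝ} {r : ℝ} (hr : 0 < r) (h0 : g 0 = 0)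
    (hg : ∀ t ∈ Metric.ball (0 : ℝ) r, HasDerivAt g (g' t) t) :
    ¬ ∀ t ∈ Metric.ball (0 : ℝ) r, g t * g' t = -t := by
  intro heq
  have hd : ∀ t ∈ Metric.ball (0 : ℝ) r, HasDerivAt (fun s => g s ^ 2 + s ^ 2) 0 t := by
    intro t ht
    refine (((hg t ht).pow 2).add ((hasDerivAt_id t).pow 2)).congr_deriv ?_
    have h := heq t ht
    norm_num
    linarith
  have hmem : r / 2 ∈ Metric.ball (0 : ℝ) r := by
    rw [Metric.mem_ball, Real.dist_eq, sub_zero, abs_of_pos (half_pos hr)]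
    exact half_lt_self hr
  have hconst := Metric.isOpen_ball.is_const_of_deriv_eq_zero
    (convex_ball (0 : ℝ) r).isPreconnected
    (fun t ht => (hd t ht).differentiableAt.differentiableWithinAt)
    (fun t ht => (hd t ht).deriv) hmem (Metric.mem_ball_self hr)
  simp only [h0] at hconst
  nlinarith [sq_nonneg (g (r / 2)), sq_pos_of_pos (half_pos hr)]

/-- Orientation rigidity of the Martinet plane: no real-analytic diffeomorphism
germ at `0 ∈ ℝ²` preserves the Martinet 2-form `x dx∧dy` while sending the
coordinate `y` to `−y`. -/
theorem no_orientation_reversing_symmetry :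
    ¬ ∃ Φ : ℝ × ℝ → ℝ × ℝ, IsAnalyticDiffeoGermAtZero Φ ∧
      (∀ᶠ z in 𝓝 (0 : ℝ × ℝ), (Φ z).1 * jacDet Φ z = z.1) ∧
      (∀ᶠ z in 𝓝 (0 : ℝ × ℝ), (Φ z).2 = -z.2) := by
  rintro ⟨Φ, ⟨hΦ, hΦ0, -⟩, hform, hsnd⟩
  obtain ⟨r, hr, hball⟩ := Metric.eventually_nhds_iff_ball.1
    (hΦ.eventually_analyticAt.and (hform.and hsnd.eventually_nhds))
  have hline : ∀ t ∈ Metric.ball (0 : ℝ) r, ((t, 0) : ℝ × ℝ) ∈ Metric.ball (0 : ℝ × ℝ) r := by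
    intro t ht
    simpa [Prod.norm_def, hr] using ht
  refine not_forall_hasDerivAt_mul_eq_neg (g := fun t => (Φ (t, 0)).1)
    (g' := fun t => pdx (fun w => (Φ w).1) (t, 0)) hr ?_ ?_ ?_
  · exact congrArg Prod.fst hΦ0
  · intro t ht
    have hcurve : HasDerivAt (fun s : ℝ => ((s, 0) : ℝ × ℝ)) (1, 0) t :=
      (hasDerivAt_id t).prodMk (hasDerivAt_const t 0)
    have hfst := (hball _ (hline t ht)).1.differentiableAt.fst.hasFDerivAt
    exact HasFDerivAt.comp_hasDerivAt (l := fun w => (Φ w).1) t hfst hcurve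
  · intro t ht
    obtain ⟨-, h, hy⟩ := hball _ (hline t ht)
    rw [jacDet_eq_neg_pdx hy] at h
    linarith
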